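/- arXiv:2503.01010 — 2 statements merged into one kernel-verified Lean document; each statement's English description precedes it below -/
import Mathlib

section
/- Let $h_L > 0$, $k_L > 0$, $h_R > 0$, $k_R < 0$, $\mathcal{E} \ge 0$, $\rho > 0$, $c > 0$ be real numbers, and let $C$ be the $3 \times 3$ real matrix $C = \begin{pmatrix} h_L & 0 & k_L \\ 0 & h_R & k_R \\ 1 & -1 & -\frac{\mathcal{E}}{(\rho c)^2} \end{pmatrix}$. Then $C$ is invertible, and for every $g \in \mathbb{R}^3$ there exists a unique $x \in \mathbb{R}^3$ with $C x = g$. -/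
/-- In the left-rarefaction case the coupled GRP coefficient matrix is
invertible and the linear system is uniquely solvable for any right-hand
side. -/
theorem coupled_grp_matrix_rarefaction_invertible
    (hL kL hR kR E ρ c : ℝ)
    (hhL : 0 < hL) (hkL : 0 < kL) (hhR : 0 < hR) (hkR : kR < 0)
    (hE : 0 ≤ E) (hρ : 0 < ρ) (hc : 0 < c) :
    IsUnit (!![hL, 0, kL;
               0, hR, kR;
               1, -1, -(E / (ρ * c) ^ 2)] : Matrix (Fin 3) (Fin 3) ℝ) ∧
    ∀ g : Fin 3 → ℝ, ∃! x : Fin 3 → ℝ,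
      (!![hL, 0, kL;
          0, hR, kR;
          1, -1, -(E / (ρ * c) ^ 2)] : Matrix (Fin 3) (Fin 3) ℝ).mulVec x = g := by
  have he : 0 ≤ E / (ρ * c) ^ 2 := by positivity
  generalize E / (ρ * c) ^ 2 = e at he ⊢
  have hC : IsUnit (!![hL, 0, kL; 0, hR, kR; 1, -1, -e] : Matrix (Fin 3) (Fin 3) ℝ) := by
    rw [Matrix.isUnit_iff_isUnit_det, isUnit_iff_ne_zero]
    refine ne_of_lt ?_
    have h₁ : 0 ≤ hL * hR * e := by positivity
    have h₂ : hL * kR < 0 := mul_neg_of_pos_of_neg hhL hkR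
    have h₃ : 0 < kL * hR := mul_pos hkL hhR
    simp [Matrix.det_fin_three]
    linarith
  exact ⟨hC, Function.Bijective.existsUnique
    ⟨Matrix.mulVec_injective_iff_isUnit.mpr hC, Matrix.mulVec_surjective_iff_isUnit.mpr hC⟩⟩
end

section
/- Let $\overline{\rho} > 0$, $\overline{c} > 0$, $\rho > 0$, $c > 0$, $\mathcal{E} \ge 0$ be real numbers, and let $\overline{u}, u$ be real numbers with $0 \le \overline{u} < \overline{c}$ and $0 \le u < c$ (both intermediate states subsonic with nonnegative velocity). Define $h_L = \frac{\overline{c} - \overline{u}}{\overline{c}}$, $k_L = \frac{\overline{c} - \overline{u}}{\overline{\rho}\, \overline{c}^2}$, $h_R = \frac{c + u}{c}$, $k_R = -\frac{c + u}{\rho c^2}$, and let $C = \begin{pmatrix} h_L & 0 & k_L \\ 0 & h_R & k_R \\ 1 & -1 & -\frac{\mathcal{E}}{(\overline{\rho}\, \overline{c})^2} \end{pmatrix}$. Then $\det C < 0$; in particular, for every right-hand side $g \in \mathbb{R}^3$ the linear system $C x = g$ has a unique solution $x \in \mathbb{R}^3$. -/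
/-- When both the 1-wave and the 3-wave are rarefactions, the coupled GRP
coefficient matrix built from the explicit coefficients has negative
determinant, hence the linear system is uniquely solvable. -/
theorem coupled_grp_both_rarefactions_solvable
    (ρbar cbar ρ c E ubar u : ℝ)
    (hρbar : 0 < ρbar) (hcbar : 0 < cbar) (hρ : 0 < ρ) (hc : 0 < c)
    (hE : 0 ≤ E)
    (hubar0 : 0 ≤ ubar) (hubarc : ubar < cbar)
    (hu0 : 0 ≤ u) (huc : u < c)
    (hL kL hR kR : ℝ)
    (hhL : hL = (cbar - ubar) / cbar)
    (hkL : kL = (cbar - ubar) / (ρbar * cbar ^ 2))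
    (hhR : hR = (c + u) / c)
    (hkR : kR = -((c + u) / (ρ * c ^ 2)))
    (C : Matrix (Fin 3) (Fin 3) ℝ)
    (hC : C = !![hL, 0, kL;
                 0, hR, kR;
                 1, -1, -(E / (ρbar * cbar) ^ 2)]) :
    C.det < 0 ∧ ∀ g : Fin 3 → ℝ, ∃! x : Fin 3 → ℝ, C.mulVec x = g := by
  have hhL_pos : 0 < hL := hhL ▸ div_pos (sub_pos.2 hubarc) hcbar
  have hkL_pos : 0 < kL := hkL ▸ div_pos (sub_pos.2 hubarc) (by positivity)
  have hhR_pos : 0 < hR := hhR ▸ by positivity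
  have hkR_neg : kR < 0 := hkR ▸ neg_neg_of_pos (by positivity)
  have hdet : C.det < 0 := by
    have hexpand : C.det = -(hL * hR * (E / (ρbar * cbar) ^ 2)) + hL * kR - kL * hR := by
      rw [hC, Matrix.det_fin_three]
      simp
    have hE_term : 0 ≤ hL * hR * (E / (ρbar * cbar) ^ 2) := by positivity
    have hL_term := mul_neg_of_pos_of_neg hhL_pos hkR_neg
    have hR_term := mul_pos hkL_pos hhR_pos
    linarith
  refine ⟨hdet, Function.bijective_iff_existsUnique _ |>.1 ?_⟩
  have hunit : IsUnit C := (Matrix.isUnit_iff_isUnit_det C).2 hdet.ne.isUnit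
  exact ⟨Matrix.mulVec_injective_iff_isUnit.2 hunit, Matrix.mulVec_surjective_iff_isUnit.2 hunit⟩
end
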